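/- arXiv:0811.3038 — 6 statements merged into one kernel-verified Lean document; each statement's English description precedes it below -/
import Mathlib

section
/- Let χ_F(λ) = det(λ·I − F) be the (monic, degree N) characteristic polynomial of the orbit-data isometry F. Then for every nonzero λ ∈ ℂ, χ_F(λ) = λ^N · p(1/λ) + (−1)^{ω} · p(λ), where ω is the order of σ as a permutation (ω = 1 if σ = id, ω = 2 if σ is a transposition, ω = 3 if σ is a 3-cycle) and p(λ) = 1 − 2λ + Σ_{j : σ(j) = j} λ^{1+n_j} + Σ_{j : σ(j) ≠ j} λ^{n_j}(1 − λ). -/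
open Matrix

/-- Index type for the basis `H, E_{i,k}` (`i ∈ {1,2,3}`, `0 ≤ k ≤ nᵢ − 1`) of the
orbit-data lattice: `none` stands for `H`, and `some ⟨i, k⟩` stands for `E_{i,k}`. -/
abbrev OrbIdx (n : Fin 3 → ℕ) := Option ((i : Fin 3) × Fin (n i))

/-- The intersection form `J`: `⟨H,H⟩ = 1`, `⟨E_{i,k},E_{i,k}⟩ = −1`, all other
pairings of basis vectors zero. -/
def orbJ (n : Fin 3 → ℕ) : Matrix (OrbIdx n) (OrbIdx n) ℝ :=
  Matrix.diagonal fun x => match x with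
    | none => 1
    | some _ => -1

/-- The matrix of the map `Q` (columnwise):
`Q(H) = 2H − E_{1,0} − E_{2,0} − E_{3,0}`, `Q(E_{i,0}) = H − ∑_{j≠i} E_{j,0}`,
and `Q(E_{i,k}) = E_{i,k}` for `k ≥ 1`. -/
def orbQ (n : Fin 3 → ℕ) : Matrix (OrbIdx n) (OrbIdx n) ℝ :=
  Matrix.of fun a b =>
    match a, b with
    | none, none => 2
    | none, some ⟨_, k'⟩ => if (k' : ℕ) = 0 then 1 else 0
    | some ⟨_, k⟩, none => if (k : ℕ) = 0 then -1 else 0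
    | some ⟨i, k⟩, some ⟨i', k'⟩ =>
        if (k' : ℕ) = 0 then
          (if (k : ℕ) = 0 then (if i = i' then 0 else -1) else 0)
        else (if i = i' ∧ (k : ℕ) = (k' : ℕ) then 1 else 0)

/-- The permutation of basis indices underlying `S`: `H ↦ H`,
`E_{i,k} ↦ E_{i,k−1}` for `1 ≤ k ≤ nᵢ − 1`, and `E_{σ(i),0} ↦ E_{i,nᵢ−1}`
(that is, `E_{j,0} ↦ E_{σ⁻¹(j), n_{σ⁻¹(j)}−1}`). -/
def orbPerm (n : Fin 3 → ℕ) (hn : ∀ i, 1 ≤ n i) (σ : Equiv.Perm (Fin 3)) :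
    OrbIdx n → OrbIdx n
  | none => none
  | some ⟨i, k⟩ =>
      if h : 1 ≤ (k : ℕ) then
        some ⟨i, ⟨(k : ℕ) - 1, by have := k.isLt; omega⟩⟩
      else
        some ⟨σ.symm i, ⟨n (σ.symm i) - 1, by have := hn (σ.symm i); omega⟩⟩

/-- The matrix of the permutation map `S`: `S(H) = H`, `S(E_{i,k}) = E_{i,k−1}`
for `1 ≤ k ≤ nᵢ − 1`, and `S(E_{σ(i),0}) = E_{i,nᵢ−1}`. -/
def orbS (n : Fin 3 → ℕ) (hn : ∀ i, 1 ≤ n i) (σ : Equiv.Perm (Fin 3)) :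
    Matrix (OrbIdx n) (OrbIdx n) ℝ :=
  Matrix.of fun a b => if a = orbPerm n hn σ b then 1 else 0

/-- The orbit-data isometry `F = S ∘ Q` for the orbit data `n₁, n₂, n₃, σ`. -/
def orbF (n : Fin 3 → ℕ) (hn : ∀ i, 1 ≤ n i) (σ : Equiv.Perm (Fin 3)) :
    Matrix (OrbIdx n) (OrbIdx n) ℝ :=
  orbS n hn σ * orbQ n

open Finset in
/-- The Bedford–Kim polynomial `p(λ)` associated to orbit data `n₁,n₂,n₃,σ`:
`p(λ) = 1 − 2λ + ∑_{j : σ(j)=j} λ^{1+n_j} + ∑_{j : σ(j)≠j} λ^{n_j}(1 − λ)`. -/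
noncomputable def orbP (n : Fin 3 → ℕ) (σ : Equiv.Perm (Fin 3)) (t : ℂ) : ℂ :=
  1 - 2 * t + ∑ j ∈ univ.filter (fun j => σ j = j), t ^ (1 + n j)
    + ∑ j ∈ univ.filter (fun j => σ j ≠ j), t ^ (n j) * (1 - t)

/-- A block triangular matrix whose diagonal blocks are the scalar `c` has determinant
`c ^ card m`. -/
theorem Matrix.BlockTriangular.det_eq_pow_card {m α R : Type*} [Fintype m] [DecidableEq m]
    [LinearOrder α] [CommRing R] {M : Matrix m m R} {b : m → α} (hM : M.BlockTriangular b) (c : R)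
    (hc : ∀ i j, b i = b j → M i j = if i = j then c else 0) :
    M.det = c ^ Fintype.card m := by
  have hblock (a : α) :
      (M.toSquareBlock b a).det = c ^ (Finset.univ.filter fun i => b i = a).card := by
    have : M.toSquareBlock b a = c • (1 : Matrix {i // b i = a} {i // b i = a} R) := by
      ext i j
      simp [Matrix.toSquareBlock_def, hc _ _ (i.2.trans j.2.symm), Matrix.one_apply,
        Subtype.ext_iff]
    rw [this, Matrix.det_smul, Matrix.det_one, mul_one, Fintype.card_subtype]
  rw [hM.det, Finset.prod_congr rfl fun a _ => hblock a, Finset.prod_pow_eq_pow_sum,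
    ← Finset.card_eq_sum_card_image, Finset.card_univ]

/-- The indices `H`, `E_{1,0}`, `E_{2,0}`, `E_{3,0}` on which `Q` acts nontrivially. -/
def orbHead (n : Fin 3 → ℕ) (hn : ∀ i, 1 ≤ n i) : Option (Fin 3) → OrbIdx n
  | none => none
  | some i => some ⟨i, ⟨0, hn i⟩⟩

/-- The height of a basis index: `E_{i,k}` has height `k`, and `H` has height `0`. -/
def orbHeight (n : Fin 3 → ℕ) : OrbIdx n → ℕ
  | none => 0
  | some ⟨_, k⟩ => k

/-- The nilpotent part of `F`: `E_{i,k} ↦ E_{i,k-1}` for `k ≥ 1`, all other basis vectors `↦ 0`. -/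
def orbShift (n : Fin 3 → ℕ) (hn : ∀ i, 1 ≤ n i) (σ : Equiv.Perm (Fin 3)) :
    Matrix (OrbIdx n) (OrbIdx n) ℂ :=
  Matrix.of fun a b => if orbHeight n b ≠ 0 ∧ a = orbPerm n hn σ b then 1 else 0

/-- The coordinate projection onto the span of the `orbHead` basis vectors. -/
def orbProj (n : Fin 3 → ℕ) (hn : ∀ i, 1 ≤ n i) : Matrix (Option (Fin 3)) (OrbIdx n) ℂ :=
  Matrix.of fun y b => if b = orbHead n hn y then 1 else 0

/-- The composite `orbProj * (t⁻¹ • 1 - orbShift)⁻¹` in closed form. -/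
def orbRes (n : Fin 3 → ℕ) (t : ℂ) : Matrix (Option (Fin 3)) (OrbIdx n) ℂ :=
  Matrix.of fun y a =>
    match y, a with
    | none, none => t
    | none, some _ => 0
    | some _, none => 0
    | some i, some ⟨i', k⟩ => if i = i' then t ^ ((k : ℕ) + 1) else 0

section

variable (n : Fin 3 → ℕ) (hn : ∀ i, 1 ≤ n i) (σ : Equiv.Perm (Fin 3))

theorem orbHeight_orbPerm {b : OrbIdx n} (hb : orbHeight n b ≠ 0) :
    orbHeight n (orbPerm n hn σ b) + 1 = orbHeight n b := by
  rcases b with _ | ⟨i, k⟩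
  · exact absurd rfl hb
  · have hk : 1 ≤ (k : ℕ) := Nat.one_le_iff_ne_zero.2 hb
    simp only [orbPerm, hk, dif_pos, orbHeight]
    omega

theorem orbHeight_eq_zero_iff {b : OrbIdx n} :
    orbHeight n b = 0 ↔ ∃ y, b = orbHead n hn y := by
  constructor
  · rcases b with _ | ⟨i, k⟩
    · exact fun _ => ⟨none, rfl⟩
    · intro h
      obtain rfl : k = ⟨0, hn i⟩ := Fin.ext h
      exact ⟨some i, rfl⟩
  · rintro ⟨_ | i, rfl⟩ <;> rfl

theorem orbHead_injective : Function.Injective (orbHead n hn) := by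
  rintro (_ | i) (_ | j) h <;> simp_all [orbHead]

theorem det_smul_one_sub_orbShift (c : ℂ) :
    (c • 1 - orbShift n hn σ).det = c ^ (1 + n 0 + n 1 + n 2) := by
  have key (a b : OrbIdx n) (h : orbHeight n b ≤ orbHeight n a) : orbShift n hn σ a b = 0 := by
    refine if_neg ?_
    rintro ⟨hb, rfl⟩
    have := orbHeight_orbPerm n hn σ hb
    omega
  have hM : (c • 1 - orbShift n hn σ).BlockTriangular (orbHeight n) := by
    intro a b h
    have hab : a ≠ b := by rintro rfl; exact lt_irrefl _ h
    simp [key a b h.le, hab]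
  rw [hM.det_eq_pow_card c fun a b h => by simp [key a b h.ge, Matrix.one_apply]]
  congr 1
  simp [Fin.sum_univ_three]
  ring

theorem orbQ_of_height_ne_zero (a : OrbIdx n) {b : OrbIdx n} (hb : orbHeight n b ≠ 0) :
    orbQ n a b = if a = b then 1 else 0 := by
  rcases b with _ | ⟨j, l⟩
  · exact absurd rfl hb
  · have hl : (l : ℕ) ≠ 0 := hb
    rcases a with _ | ⟨i, k⟩
    · simp [orbQ, hl]
    · simp only [orbQ, Matrix.of_apply, hl, if_false]
      congr 1
      rw [Option.some_inj, Sigma.mk.injEq]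
      refine propext (and_congr_right ?_)
      rintro rfl
      simp [Fin.ext_iff]

theorem orbF_map_eq :
    (orbF n hn σ).map Complex.ofReal = orbShift n hn σ +
      ((orbF n hn σ).map Complex.ofReal).submatrix id (orbHead n hn) * orbProj n hn := by
  ext a b
  rw [Matrix.add_apply, Matrix.mul_apply]
  by_cases hb : orbHeight n b = 0
  · obtain ⟨y, rfl⟩ := (orbHeight_eq_zero_iff n hn).1 hb
    simp [orbShift, hb, orbProj, (orbHead_injective n hn).eq_iff]
  · have h0 (y) : orbProj n hn y b = 0 :=
      if_neg fun h => hb ((orbHeight_eq_zero_iff n hn).2 ⟨y, h⟩)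
    simp [h0, orbShift, hb, orbF, Matrix.mul_apply, orbS, orbQ_of_height_ne_zero n _ hb,
      apply_ite Complex.ofReal]

theorem orbRes_mul {c : ℂ} (hc : c ≠ 0) :
    orbRes n c⁻¹ * (c • 1 - orbShift n hn σ) = orbProj n hn := by
  ext y b
  rw [Matrix.mul_sub, Matrix.mul_smul, Matrix.mul_one, Matrix.sub_apply, Matrix.mul_apply]
  by_cases hb : orbHeight n b = 0
  · obtain ⟨z, rfl⟩ := (orbHeight_eq_zero_iff n hn).1 hb
    have hS (a) : orbShift n hn σ a (orbHead n hn z) = 0 := if_neg fun h => h.1 hb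
    simp only [hS, mul_zero, Finset.sum_const_zero, sub_zero]
    rcases y with _ | i <;> rcases z with _ | j
    · simp [orbProj, orbRes, orbHead, hc]
    · simp [orbProj, orbRes, orbHead]
    · simp [orbProj, orbRes, orbHead]
    · by_cases hij : i = j
      · simp [orbProj, orbRes, orbHead, hc, hij]
      · simp [orbProj, orbRes, orbHead, hij, Ne.symm hij]
  · have h0 : orbProj n hn y b = 0 :=
      if_neg fun h => hb ((orbHeight_eq_zero_iff n hn).2 ⟨y, h⟩)
    rw [h0]
    simp only [orbShift, Matrix.of_apply, hb, ne_eq, not_false_eq_true, true_and, mul_ite, mul_one,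
      mul_zero, Finset.sum_ite_eq', Finset.mem_univ, if_true]
    rcases b with _ | ⟨j, k⟩
    · exact absurd rfl hb
    · have hk : 1 ≤ (k : ℕ) := Nat.one_le_iff_ne_zero.2 hb
      rcases y with _ | i
      · simp [orbRes, orbPerm, hk]
      · by_cases hij : i = j
        · rw [Matrix.smul_apply]
          simp only [orbRes, orbPerm, hk, hij, dite_true, if_true, Matrix.of_apply, smul_eq_mul,
            Nat.sub_add_cancel hk]
          rw [pow_succ', mul_inv_cancel_left₀ hc, sub_self]
        · simp [orbRes, orbPerm, hk, hij]

/-- The compression of `F` to the `orbHead` coordinates through `orbRes`. -/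
def orbCompress (t : ℂ) : Matrix (Option (Fin 3)) (Option (Fin 3)) ℂ :=
  Matrix.of fun y z =>
    match y, z with
    | none, none => 2 * t
    | none, some _ => t
    | some i, none => -t ^ n i
    | some i, some j => if σ i = j then 0 else -t ^ n i

theorem orbRes_mul_orbF_submatrix (t : ℂ) :
    orbRes n t * ((orbF n hn σ).map Complex.ofReal).submatrix id (orbHead n hn) =
      orbCompress n σ t := by
  have hF (y z) :
      (orbRes n t * ((orbF n hn σ).map Complex.ofReal).submatrix id (orbHead n hn)) y z =
        ∑ d, orbRes n t y (orbPerm n hn σ d) * (orbQ n d (orbHead n hn z) : ℂ) := by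
    simp only [Matrix.mul_apply, Matrix.submatrix_apply, Matrix.map_apply, id, orbF,
      Complex.ofReal_sum, Complex.ofReal_mul, Finset.mul_sum]
    rw [Finset.sum_comm]
    refine Finset.sum_congr rfl fun d _ => ?_
    simp [orbS, apply_ite Complex.ofReal, -Fintype.sum_option]
  have hsum (f : OrbIdx n → ℂ) (hf : ∀ d, orbHeight n d ≠ 0 → f d = 0) :
      ∑ d, f d = ∑ w, f (orbHead n hn w) := by
    refine (Fintype.sum_of_injective _ (orbHead_injective n hn) _ _ (fun d hd => hf d fun h => ?_)
      fun _ => rfl).symm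
    obtain ⟨w, rfl⟩ := (orbHeight_eq_zero_iff n hn).1 h
    exact hd ⟨w, rfl⟩
  have hres (i j : Fin 3) : orbRes n t (some i) (orbPerm n hn σ (orbHead n hn (some j))) =
      if σ i = j then t ^ n i else 0 := by
    simp only [orbRes, orbPerm, orbHead, Matrix.of_apply]
    simp only [nonpos_iff_eq_zero, one_ne_zero, dite_false, Equiv.eq_symm_apply]
    split_ifs with h
    · subst h
      have := hn i
      simp [Nat.sub_add_cancel this]
    · rfl
  ext y z
  rw [hF, hsum]
  · rw [Fintype.sum_option]
    rcases y with _ | i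
    · rcases z with _ | j <;>
        simp [orbRes, orbPerm, orbHead, orbQ, orbCompress, mul_comm]
    · simp only [hres]
      rcases z with _ | j
      · simp [orbRes, orbPerm, orbHead, orbQ, orbCompress]
      · simp only [ite_mul, zero_mul, Finset.sum_ite_eq, Finset.mem_univ, if_true]
        by_cases hij : σ i = j <;> simp [orbRes, orbPerm, orbHead, orbQ, orbCompress, hij]
  · intro d hd
    rcases d with _ | ⟨j, k⟩
    · exact absurd rfl hd
    · have hk : (k : ℕ) ≠ 0 := hd
      rcases z with _ | i <;> simp [orbQ, orbHead, hk]

theorem det_smul_one_sub_orbF {c : ℂ} (hc : c ≠ 0) :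
    (c • 1 - (orbF n hn σ).map Complex.ofReal).det =
      c ^ (1 + n 0 + n 1 + n 2) * (1 - orbCompress n σ c⁻¹).det := by
  rw [orbF_map_eq, ← sub_sub, ← orbRes_mul n hn σ hc, ← Matrix.mul_assoc, ← one_sub_mul,
    Matrix.det_mul, Matrix.det_one_sub_mul_comm, orbRes_mul_orbF_submatrix,
    det_smul_one_sub_orbShift, mul_comm]

theorem det_one_sub_orbCompress (t : ℂ) :
    (1 - orbCompress n σ t).det = Matrix.det
      !![1 - 2 * t, -t, -t, -t;
        t ^ n 0, (if σ 0 = 0 then 1 else 1 + t ^ n 0), (if σ 0 = 1 then 0 else t ^ n 0),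
          (if σ 0 = 2 then 0 else t ^ n 0);
        t ^ n 1, (if σ 1 = 0 then 0 else t ^ n 1), (if σ 1 = 1 then 1 else 1 + t ^ n 1),
          (if σ 1 = 2 then 0 else t ^ n 1);
        t ^ n 2, (if σ 2 = 0 then 0 else t ^ n 2), (if σ 2 = 1 then 0 else t ^ n 2),
          (if σ 2 = 2 then 1 else 1 + t ^ n 2)] := by
  have h1 : finSuccEquiv 3 1 = some 0 := rfl
  have h2 : finSuccEquiv 3 2 = some 1 := rfl
  have h3 : finSuccEquiv 3 3 = some 2 := rfl
  rw [← Matrix.det_submatrix_equiv_self (finSuccEquiv 3)]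
  congr 1
  ext y z
  fin_cases y <;> fin_cases z <;> simp [orbCompress, h1, h2, h3] <;> split_ifs <;> simp

end

theorem Equiv.Perm.fin_three_cases (σ : Equiv.Perm (Fin 3)) :
    (σ 0 = 0 ∧ σ 1 = 1 ∧ σ 2 = 2 ∧ orderOf σ = 1) ∨
    (σ 0 = 1 ∧ σ 1 = 0 ∧ σ 2 = 2 ∧ orderOf σ = 2) ∨
    (σ 0 = 2 ∧ σ 1 = 1 ∧ σ 2 = 0 ∧ orderOf σ = 2) ∨
    (σ 0 = 0 ∧ σ 1 = 2 ∧ σ 2 = 1 ∧ orderOf σ = 2) ∨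
    (σ 0 = 1 ∧ σ 1 = 2 ∧ σ 2 = 0 ∧ orderOf σ = 3) ∨
    (σ 0 = 2 ∧ σ 1 = 0 ∧ σ 2 = 1 ∧ orderOf σ = 3) := by
  have : Fact (Nat.Prime 2) := ⟨Nat.prime_two⟩
  have : Fact (Nat.Prime 3) := ⟨Nat.prime_three⟩
  have h : (σ 0 = 0 ∧ σ 1 = 1 ∧ σ 2 = 2 ∧ σ = 1) ∨
    (σ 0 = 1 ∧ σ 1 = 0 ∧ σ 2 = 2 ∧ σ ^ 2 = 1 ∧ σ ≠ 1) ∨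
    (σ 0 = 2 ∧ σ 1 = 1 ∧ σ 2 = 0 ∧ σ ^ 2 = 1 ∧ σ ≠ 1) ∨
    (σ 0 = 0 ∧ σ 1 = 2 ∧ σ 2 = 1 ∧ σ ^ 2 = 1 ∧ σ ≠ 1) ∨
    (σ 0 = 1 ∧ σ 1 = 2 ∧ σ 2 = 0 ∧ σ ^ 3 = 1 ∧ σ ≠ 1) ∨
    (σ 0 = 2 ∧ σ 1 = 0 ∧ σ 2 = 1 ∧ σ ^ 3 = 1 ∧ σ ≠ 1) := by
    revert σ
    decide
  rcases h with ⟨h0, h1, h2, h⟩ | ⟨h0, h1, h2, h, hne⟩ | ⟨h0, h1, h2, h, hne⟩ |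
    ⟨h0, h1, h2, h, hne⟩ | ⟨h0, h1, h2, h, hne⟩ | ⟨h0, h1, h2, h, hne⟩
  · simp [h]
  all_goals simp [h0, h1, h2, orderOf_eq_prime h hne]

/-- The Bedford–Kim formula: for every nonzero `λ ∈ ℂ`, the
characteristic polynomial `χ_F(λ) = det(λ·I − F)` of the orbit-data isometry of
orbit data `n₁,n₂,n₃,σ` satisfies `χ_F(λ) = λ^N p(1/λ) + (−1)^ω p(λ)` where
`N = 1 + n₁ + n₂ + n₃` and `ω` is the order of `σ`. -/
theorem orbF_charpoly_formula
    (n : Fin 3 → ℕ) (hn : ∀ i, 1 ≤ n i) (σ : Equiv.Perm (Fin 3)) :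
    ∀ lam : ℂ, lam ≠ 0 →
      (lam • 1 - (orbF n hn σ).map Complex.ofReal).det
        = lam ^ (1 + n 0 + n 1 + n 2) * orbP n σ (1 / lam)
          + (-1) ^ (orderOf σ) * orbP n σ lam := by
  intro c hc
  rw [det_smul_one_sub_orbF n hn σ hc, det_one_sub_orbCompress]
  simp only [orbP, Finset.sum_filter, Fin.sum_univ_three]
  rcases σ.fin_three_cases with h | h | h | h | h | h <;>
    obtain ⟨h0, h1, h2, h⟩ := h <;>
    simp [h0, h1, h2, h, Matrix.det_succ_row_zero, Fin.sum_univ_succ, Fin.succAbove] <;>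
    field_simp <;>
    ring
end

section
/- Let n₁,n₂,n₃ ≥ 1 be integers and let a ∈ ℂ with a ≠ 0, a ≠ 1, and a^{n_j} ≠ 1 for j = 1,2,3. Set N = 1+n₁+n₂+n₃ and p(λ) = 1 − 2λ + λ^{1+n₁} + λ^{1+n₂} + λ^{1+n₃}. Then (a−1)/(1−a^{n₁}) + (a−1)/(1−a^{n₂}) + (a−1)/(1−a^{n₃}) = a − 2 holds if and only if a^N · p(1/a) = p(a). -/
/-- For `n₁,n₂,n₃ ≥ 1` and `a ∈ ℂ` with `a ≠ 0`, `a ≠ 1`,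
`a^{n_j} ≠ 1`, setting `N = 1+n₁+n₂+n₃` and
`p(λ) = 1 − 2λ + λ^{1+n₁} + λ^{1+n₂} + λ^{1+n₃}`, one has
`∑_j (a−1)/(1−a^{n_j}) = a − 2` iff `a^N p(1/a) = p(a)`. -/
theorem cuspidal_multiplier_condition_iff_charpoly_root_id
    (n₁ n₂ n₃ : ℕ) (h₁ : 1 ≤ n₁) (h₂ : 1 ≤ n₂) (h₃ : 1 ≤ n₃)
    (a : ℂ) (ha0 : a ≠ 0) (ha1 : a ≠ 1)
    (e₁ : a ^ n₁ ≠ 1) (e₂ : a ^ n₂ ≠ 1) (e₃ : a ^ n₃ ≠ 1) :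
    ((a - 1) / (1 - a ^ n₁) + (a - 1) / (1 - a ^ n₂) + (a - 1) / (1 - a ^ n₃)
        = a - 2) ↔
      a ^ (1 + n₁ + n₂ + n₃) *
          (1 - 2 * (1 / a) + (1 / a) ^ (1 + n₁) + (1 / a) ^ (1 + n₂)
            + (1 / a) ^ (1 + n₃))
        = 1 - 2 * a + a ^ (1 + n₁) + a ^ (1 + n₂) + a ^ (1 + n₃) := by
  have reciprocal :
      a ^ (1 + n₁ + n₂ + n₃) *
          (1 - 2 * (1 / a) + (1 / a) ^ (1 + n₁) + (1 / a) ^ (1 + n₂)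
            + (1 / a) ^ (1 + n₃))
        = (a - 2) * (a ^ n₁ * a ^ n₂ * a ^ n₃)
          + a ^ n₂ * a ^ n₃ + a ^ n₁ * a ^ n₃ + a ^ n₁ * a ^ n₂ := by
    simp only [one_div, inv_pow, pow_add, pow_one]
    field_simp
  rw [reciprocal]
  simp only [pow_add, pow_one]
  have d₁ : 1 - a ^ n₁ ≠ 0 := sub_ne_zero.mpr e₁.symm
  have d₂ : 1 - a ^ n₂ ≠ 0 := sub_ne_zero.mpr e₂.symm
  have d₃ : 1 - a ^ n₃ ≠ 0 := sub_ne_zero.mpr e₃.symm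
  generalize a ^ n₁ = x at *
  generalize a ^ n₂ = y at *
  generalize a ^ n₃ = z at *
  rw [div_add_div _ _ d₁ d₂, div_add_div _ _ (mul_ne_zero d₁ d₂) d₃,
    div_eq_iff (mul_ne_zero (mul_ne_zero d₁ d₂) d₃)]
  constructor <;> intro h <;> linear_combination h
end

section
/- Let n₁,n₂,n₃ ≥ 1 be integers and let a ∈ ℂ be a number that is not 0 and not a root of unity (in particular a ≠ 1, a^{n₁+n₂} ≠ 1, a^{n₃} ≠ 1). Define x₁ = (a−1)(1+a^{n₂})/(1−a^{n₁+n₂}), x₂ = (a−1)(1+a^{n₁})/(1−a^{n₁+n₂}), x₃ = (a−1)/(1−a^{n₃}). Then: (i) a^{n₁}·x₁ = x₂ − (a−1), a^{n₂}·x₂ = x₁ − (a−1), and a^{n₃}·x₃ = x₃ − (a−1); and (ii) x₁ + x₂ + x₃ = a − 2 holds if and only if a^N·p(1/a) + p(a) = 0, where N = 1+n₁+n₂+n₃ and p(λ) = 1 − 2λ + λ^{1+n₃} + (λ^{n₁} + λ^{n₂})(1−λ). -/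
/-- The orbit equations and the characteristic-polynomial
criterion for tentative realizations on a cuspidal cubic, for orbit data
`n₁,n₂,n₃` with `σ` the transposition exchanging `1` and `2`. -/
theorem cuspidal_tentative_realization_transposition
    (n₁ n₂ n₃ : ℕ) (h₁ : 1 ≤ n₁) (h₂ : 1 ≤ n₂) (h₃ : 1 ≤ n₃)
    (a : ℂ) (ha0 : a ≠ 0) (hru : ∀ k : ℕ, 1 ≤ k → a ^ k ≠ 1)
    (x₁ x₂ x₃ : ℂ)
    (hx₁ : x₁ = (a - 1) * (1 + a ^ n₂) / (1 - a ^ (n₁ + n₂)))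
    (hx₂ : x₂ = (a - 1) * (1 + a ^ n₁) / (1 - a ^ (n₁ + n₂)))
    (hx₃ : x₃ = (a - 1) / (1 - a ^ n₃)) :
    (a ^ n₁ * x₁ = x₂ - (a - 1) ∧ a ^ n₂ * x₂ = x₁ - (a - 1) ∧
        a ^ n₃ * x₃ = x₃ - (a - 1)) ∧
      ((x₁ + x₂ + x₃ = a - 2) ↔
        a ^ (1 + n₁ + n₂ + n₃) *
            (1 - 2 * (1 / a) + (1 / a) ^ (1 + n₃)
              + ((1 / a) ^ n₁ + (1 / a) ^ n₂) * (1 - 1 / a))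
          + (1 - 2 * a + a ^ (1 + n₃) + (a ^ n₁ + a ^ n₂) * (1 - a)) = 0) := by
  have huv : 1 - a ^ n₁ * a ^ n₂ ≠ 0 := by
    rw [← pow_add]
    exact sub_ne_zero.mpr (hru (n₁ + n₂) (by omega)).symm
  have hw : 1 - a ^ n₃ ≠ 0 := sub_ne_zero.mpr (hru n₃ h₃).symm
  have hu0 : a ^ n₁ ≠ 0 := pow_ne_zero _ ha0
  have hv0 : a ^ n₂ ≠ 0 := pow_ne_zero _ ha0
  have hw0 : a ^ n₃ ≠ 0 := pow_ne_zero _ ha0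
  subst hx₁ hx₂ hx₃
  simp only [pow_add, pow_one, one_div, inv_pow]
  generalize a ^ n₁ = u at *
  generalize a ^ n₂ = v at *
  generalize a ^ n₃ = w at *
  have hvu : 1 - v * u ≠ 0 := by rwa [mul_comm]
  refine ⟨⟨by field_simp; ring, by field_simp; ring, by field_simp; ring⟩, ?_⟩
  have key : a * u * v * w * (1 - 2 * a⁻¹ + a⁻¹ * w⁻¹ + (u⁻¹ + v⁻¹) * (1 - a⁻¹))
        + (1 - 2 * a + a * w + (u + v) * (1 - a))
      = -(((a - 1) * (1 + v) / (1 - u * v) + (a - 1) * (1 + u) / (1 - u * v)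
          + (a - 1) / (1 - w) - (a - 2)) * ((1 - u * v) * (1 - w))) := by
    field_simp
    ring
  rw [key, neg_eq_zero, mul_eq_zero_iff_right (mul_ne_zero huv hw), sub_eq_zero]
end

section
/- Let n₁,n₂,n₃ ≥ 1 be integers and let a ∈ ℂ be a number that is not 0 and not a root of unity (in particular a ≠ 1 and a^{n₁+n₂+n₃} ≠ 1). Define x₁ = (a−1)(1+a^{n₃}+a^{n₂+n₃})/(1−a^{n₁+n₂+n₃}), x₂ = (a−1)(1+a^{n₁}+a^{n₃+n₁})/(1−a^{n₁+n₂+n₃}), x₃ = (a−1)(1+a^{n₂}+a^{n₁+n₂})/(1−a^{n₁+n₂+n₃}). Then: (i) a^{n₁}·x₁ = x₂ − (a−1), a^{n₂}·x₂ = x₃ − (a−1), and a^{n₃}·x₃ = x₁ − (a−1); and (ii) x₁ + x₂ + x₃ = a − 2 holds if and only if a^N·p(1/a) − p(a) = 0, where N = 1+n₁+n₂+n₃ and p(λ) = 1 − 2λ + (λ^{n₁} + λ^{n₂} + λ^{n₃})(1−λ). -/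
/-- The orbit equations and the characteristic-polynomial
criterion for tentative realizations on a cuspidal cubic, for orbit data
`n₁,n₂,n₃` with `σ` the cyclic permutation `1 ↦ 2 ↦ 3`. -/
theorem cuspidal_tentative_realization_cyclic
    (n₁ n₂ n₃ : ℕ) (h₁ : 1 ≤ n₁) (h₂ : 1 ≤ n₂) (h₃ : 1 ≤ n₃)
    (a : ℂ) (ha0 : a ≠ 0) (hru : ∀ k : ℕ, 1 ≤ k → a ^ k ≠ 1)
    (x₁ x₂ x₃ : ℂ)
    (hx₁ : x₁ = (a - 1) * (1 + a ^ n₃ + a ^ (n₂ + n₃)) / (1 - a ^ (n₁ + n₂ + n₃)))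
    (hx₂ : x₂ = (a - 1) * (1 + a ^ n₁ + a ^ (n₃ + n₁)) / (1 - a ^ (n₁ + n₂ + n₃)))
    (hx₃ : x₃ = (a - 1) * (1 + a ^ n₂ + a ^ (n₁ + n₂)) / (1 - a ^ (n₁ + n₂ + n₃))) :
    (a ^ n₁ * x₁ = x₂ - (a - 1) ∧ a ^ n₂ * x₂ = x₃ - (a - 1) ∧
        a ^ n₃ * x₃ = x₁ - (a - 1)) ∧
      ((x₁ + x₂ + x₃ = a - 2) ↔
        a ^ (1 + n₁ + n₂ + n₃) *
            (1 - 2 * (1 / a)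
              + ((1 / a) ^ n₁ + (1 / a) ^ n₂ + (1 / a) ^ n₃) * (1 - 1 / a))
          - (1 - 2 * a + (a ^ n₁ + a ^ n₂ + a ^ n₃) * (1 - a)) = 0) := by
  have hD : 1 - a ^ (n₁ + n₂ + n₃) ≠ 0 :=
    sub_ne_zero.mpr (hru (n₁ + n₂ + n₃) (by lia)).symm
  have hA : a ^ n₁ ≠ 0 := pow_ne_zero _ ha0
  have hB : a ^ n₂ ≠ 0 := pow_ne_zero _ ha0
  have hC : a ^ n₃ ≠ 0 := pow_ne_zero _ ha0
  simp only [one_div, inv_pow, pow_add, pow_one] at hD hx₁ hx₂ hx₃ ⊢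
  generalize a ^ n₁ = A at *
  generalize a ^ n₂ = B at *
  generalize a ^ n₃ = C at *
  refine ⟨⟨?_, ?_, ?_⟩, ?_⟩
  · rw [hx₁, hx₂, mul_div_assoc', div_sub' hD]
    ring
  · rw [hx₂, hx₃, mul_div_assoc', div_sub' hD]
    ring
  · rw [hx₃, hx₁, mul_div_assoc', div_sub' hD]
    ring
  · have reciprocal : a * A * B * C * (1 - 2 * a⁻¹ + (A⁻¹ + B⁻¹ + C⁻¹) * (1 - a⁻¹))
        = A * B * C * (a - 2) + (B * C + A * C + A * B) * (a - 1) := by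
      field_simp
    rw [hx₁, hx₂, hx₃, reciprocal, ← add_div, ← add_div, div_eq_iff hD, ← sub_eq_zero]
    ring_nf
end

section
/- Let n₁, n₂, n₃ be integers with n₁ ≥ 3, n₂ ≥ 4, n₃ ≥ 4 and (n₂−2)(n₃−2) > 4. Set b₁ = (n₂n₃ − n₂ − n₃)/(n₁·(n₂n₃ − n₂ − n₃) − n₂n₃) ∈ ℚ. Then for every integer ℓ with 1 ≤ ℓ ≤ n₁ − 2 one has 0 < ℓ·b₁ < 1; in particular ℓ·b₁ is never an integer for such ℓ. -/
/-- The key inequality for realizability of orbit data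
`n₁,n₂,n₃`, `σ = id` on `{xyz = 0}`: with
`b₁ = (n₂n₃ − n₂ − n₃)/(n₁(n₂n₃ − n₂ − n₃) − n₂n₃)`, one has `0 < ℓ b₁ < 1`
for every integer `1 ≤ ℓ ≤ n₁ − 2`; in particular `ℓ b₁` is never an integer. -/
theorem orbit_data_key_inequality
    (n₁ n₂ n₃ : ℤ) (h₁ : 3 ≤ n₁) (h₂ : 4 ≤ n₂) (h₃ : 4 ≤ n₃)
    (h₄ : 4 < (n₂ - 2) * (n₃ - 2))
    (b₁ : ℚ)
    (hb₁ : b₁ = ((n₂ : ℚ) * (n₃ : ℚ) - (n₂ : ℚ) - (n₃ : ℚ)) /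
        ((n₁ : ℚ) * ((n₂ : ℚ) * (n₃ : ℚ) - (n₂ : ℚ) - (n₃ : ℚ))
          - (n₂ : ℚ) * (n₃ : ℚ))) :
    ∀ ℓ : ℤ, 1 ≤ ℓ → ℓ ≤ n₁ - 2 →
      (0 < (ℓ : ℚ) * b₁ ∧ (ℓ : ℚ) * b₁ < 1) ∧
        ¬∃ z : ℤ, (ℓ : ℚ) * b₁ = (z : ℚ) := by
  intro ℓ hℓ hℓn
  have hA : 0 < n₂ * n₃ - n₂ - n₃ := by nlinarith
  have hlt : ℓ * (n₂ * n₃ - n₂ - n₃) < n₁ * (n₂ * n₃ - n₂ - n₃) - n₂ * n₃ := by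
    nlinarith [mul_le_mul_of_nonneg_right hℓn hA.le]
  have hpos : 0 < ℓ * (n₂ * n₃ - n₂ - n₃) := mul_pos (by lia) hA
  have hD := hpos.trans hlt
  have hbounds : 0 < (ℓ : ℚ) * b₁ ∧ (ℓ : ℚ) * b₁ < 1 := by
    rw [hb₁, ← mul_div_assoc]
    refine ⟨div_pos ?_ ?_, (div_lt_one ?_).2 ?_⟩ <;> assumption_mod_cast
  refine ⟨hbounds, ?_⟩
  rintro ⟨z, hz⟩
  rw [hz] at hbounds
  norm_cast at hbounds
  lia
end

section
/- Let t₁, t₂, t₃ ∈ ℂ. Then det [[t₁², 1, t₁], [t₂², 1, t₂], [1, −t₃, 0]] = (t₂ − t₁)(1 − t₁t₂t₃). Consequently, if t₁ ≠ t₂, the three vectors (t₁², 1, t₁), (t₂², 1, t₂), (1, −t₃, 0) in ℂ³ are linearly dependent (i.e. the corresponding points [t₁²:1:t₁], [t₂²:1:t₂], [1:−t₃:0] of the projective plane are collinear) if and only if t₁t₂t₃ = 1. -/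
/-- Group law on the reducible cubic `{z(z² − xy) = 0}`:
`det [[t₁²,1,t₁],[t₂²,1,t₂],[1,−t₃,0]] = (t₂ − t₁)(1 − t₁t₂t₃)`; hence for
`t₁ ≠ t₂` the points `[t₁²:1:t₁]`, `[t₂²:1:t₂]` on the conic and `[1:−t₃:0]`
on the line are collinear iff `t₁t₂t₃ = 1`. -/
theorem conic_secant_group_law (t₁ t₂ t₃ : ℂ) :
    Matrix.det !![t₁ ^ 2, 1, t₁; t₂ ^ 2, 1, t₂; 1, -t₃, 0]
        = (t₂ - t₁) * (1 - t₁ * t₂ * t₃) ∧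
      (t₁ ≠ t₂ →
        (¬ LinearIndependent ℂ
            ![![t₁ ^ 2, 1, t₁], ![t₂ ^ 2, 1, t₂], ![(1 : ℂ), -t₃, 0]] ↔
          t₁ * t₂ * t₃ = 1)) := by
  have hdet : Matrix.det !![t₁ ^ 2, 1, t₁; t₂ ^ 2, 1, t₂; 1, -t₃, 0]
      = (t₂ - t₁) * (1 - t₁ * t₂ * t₃) := by
    simp only [Matrix.det_fin_three, Matrix.of_apply, Matrix.cons_val]
    ring
  refine ⟨hdet, fun h => ?_⟩
  have hli : LinearIndependent ℂ
      ![![t₁ ^ 2, 1, t₁], ![t₂ ^ 2, 1, t₂], ![(1 : ℂ), -t₃, 0]] ↔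
      IsUnit !![t₁ ^ 2, 1, t₁; t₂ ^ 2, 1, t₂; 1, -t₃, 0] :=
    Matrix.linearIndependent_rows_iff_isUnit
  rw [hli, Matrix.isUnit_iff_isUnit_det, hdet, isUnit_iff_ne_zero, not_not, mul_eq_zero,
    or_iff_right (sub_ne_zero.mpr h.symm), sub_eq_zero, eq_comm]
end
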